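/- Assume condition (9). Then the series S(P) converges and is a K-linear combination of multiple zeta values ζ(s_1, …, s_q) with 0 ≤ q ≤ p, s_1 ≥ 2 (when q ≥ 1), and s_1 + … + s_q ≤ A_1 + … + A_p. Moreover the combination can be chosen so that whenever ζ(s_1, …, s_q) appears with a nonzero coefficient, there exist indices 1 = ℓ_0 < ℓ_1 < … < ℓ_q = p+1 such that s_j ≤ A_{ℓ_{j−1}} + A_{ℓ_{j−1}+1} + … + A_{ℓ_j−1} for every j ∈ {1, …, q}. -/

import Mathlib

/-- The multiple zeta value `ζ(s₁, …, s_q)`, defined as a sum over strictly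
decreasing tuples `k₁ > k₂ > … > k_q ≥ 1`.  For the empty list it equals `1`. -/
noncomputable def mzv (s : List ℕ) : ℝ :=
  ∑' k : {k : Fin s.length → ℕ // StrictAnti k ∧ ∀ i, 1 ≤ k i},
    ∏ i : Fin s.length, ((k.1 i : ℝ) ^ s.get i)⁻¹

/-- The rational function `P(k₁,…,k_p) / ∏ᵢ ((kᵢ+rᵢ)_{nᵢ+1})^{Aᵢ}`, with the
Pochhammer symbol `(x)_{n+1} = x(x+1)⋯(x+n)`. -/
noncomputable def Rfun (p : ℕ) (K : Subfield ℂ) (A n r : ℕ → ℕ)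
    (P : MvPolynomial (Fin p) K) (k : Fin p → ℂ) : ℂ :=
  MvPolynomial.eval₂ K.subtype k P /
    ∏ i : Fin p, ((ascPochhammer ℂ (n i.1 + 1)).eval (k i + (r i.1 : ℂ))) ^ A i.1

open Polynomial in
/-- The rational functions over `ℚ`, restricted to `ℕ` through `k ↦ k + 1`, whose poles are
non-positive integers of order at most `t` and whose degree is at most `D`. -/
def ratFun (t : ℕ) (D : ℤ) : Submodule ℚ (ℕ → ℚ) :=
  Submodule.span ℚ {g | ∃ (N : ℕ) (p : ℚ[X]), (p.natDegree : ℤ) ≤ D + N * t ∧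
    ∀ k : ℕ, g k = p.eval ((k : ℚ) + 1) / ((ascPochhammer ℚ N).eval ((k : ℚ) + 1)) ^ t}

namespace ratFun

open Polynomial

lemma ascPochhammer_eval_ne_zero (N k : ℕ) : (ascPochhammer ℚ N).eval ((k : ℚ) + 1) ≠ 0 :=
  (ascPochhammer_pos N _ (by positivity)).ne'

lemma mem_of_natDegree_le {t N : ℕ} {D : ℤ} {p : ℚ[X]} {g : ℕ → ℚ}
    (hp : (p.natDegree : ℤ) ≤ D + N * t)
    (hg : ∀ k : ℕ, g k = p.eval ((k : ℚ) + 1) / ((ascPochhammer ℚ N).eval ((k : ℚ) + 1)) ^ t) :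
    g ∈ ratFun t D :=
  Submodule.subset_span ⟨N, p, hp, hg⟩

lemma mem_of_degree_lt {t N n : ℕ} {D : ℤ} {p : ℚ[X]} {g : ℕ → ℚ}
    (hp : p.degree < n) (hn : (n : ℤ) ≤ D + 1 + N * t)
    (hg : ∀ k : ℕ, g k = p.eval ((k : ℚ) + 1) / ((ascPochhammer ℚ N).eval ((k : ℚ) + 1)) ^ t) :
    g ∈ ratFun t D := by
  by_cases h0 : p = 0
  · have : g = 0 := by ext k; simp [hg, h0]
    rw [this]
    exact zero_mem _
  · have := (natDegree_lt_iff_degree_lt h0).2 hp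
    exact mem_of_natDegree_le (by omega) hg

lemma eval_ascPochhammer_mul (N M k : ℕ) :
    (ascPochhammer ℚ (N + M)).eval ((k : ℚ) + 1) =
      (ascPochhammer ℚ N).eval ((k : ℚ) + 1) *
        ((ascPochhammer ℚ M).comp (X + (N : ℚ[X]))).eval ((k : ℚ) + 1) := by
  rw [← eval_mul, ascPochhammer_mul]

lemma natDegree_ascPochhammer_comp (N M : ℕ) :
    ((ascPochhammer ℚ M).comp (X + (N : ℚ[X]))).natDegree = M := by
  rw [natDegree_comp, ascPochhammer_natDegree]
  rw [show (X + (N : ℚ[X])) = X + C (N : ℚ) by simp, natDegree_X_add_C, mul_one]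

lemma exists_larger {t N : ℕ} {D : ℤ} {p : ℚ[X]} (hp : (p.natDegree : ℤ) ≤ D + N * t) (M : ℕ) :
    ∃ q : ℚ[X], (q.natDegree : ℤ) ≤ D + (N + M : ℕ) * t ∧ ∀ k : ℕ,
      p.eval ((k : ℚ) + 1) / ((ascPochhammer ℚ N).eval ((k : ℚ) + 1)) ^ t =
      q.eval ((k : ℚ) + 1) / ((ascPochhammer ℚ (N + M)).eval ((k : ℚ) + 1)) ^ t := by
  refine ⟨p * ((ascPochhammer ℚ M).comp (X + (N : ℚ[X]))) ^ t, ?_, fun k => ?_⟩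
  · have h1 := natDegree_mul_le (p := p) (q := ((ascPochhammer ℚ M).comp (X + (N : ℚ[X]))) ^ t)
    have h2 := natDegree_pow_le (p := (ascPochhammer ℚ M).comp (X + (N : ℚ[X]))) (n := t)
    rw [natDegree_ascPochhammer_comp] at h2
    have h3 : (((p * ((ascPochhammer ℚ M).comp (X + (N : ℚ[X]))) ^ t).natDegree : ℕ) : ℤ) ≤
      p.natDegree + t * M := by exact_mod_cast h1.trans (by omega)
    push_cast
    linarith
  · have h1 := ascPochhammer_eval_ne_zero N k
    have h2 := ascPochhammer_eval_ne_zero (N + M) k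
    have h3 := eval_ascPochhammer_mul N M k
    rw [div_eq_div_iff (pow_ne_zero _ h1) (pow_ne_zero _ h2), h3, eval_mul, eval_pow, mul_pow]
    ring

lemma mono {t t' : ℕ} {D D' : ℤ} (ht : t ≤ t') (hD : D ≤ D') : ratFun t D ≤ ratFun t' D' := by
  refine Submodule.span_le.2 ?_
  rintro g ⟨N, p, hp, hg⟩
  obtain ⟨s, rfl⟩ := Nat.exists_eq_add_of_le ht
  refine mem_of_natDegree_le (N := N) (p := p * (ascPochhammer ℚ N) ^ s) ?_ fun k => ?_
  · have h1 := natDegree_mul_le (p := p) (q := (ascPochhammer ℚ N) ^ s)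
    have h2 := natDegree_pow_le (p := ascPochhammer ℚ N) (n := s)
    rw [ascPochhammer_natDegree] at h2
    have h3 : (((p * (ascPochhammer ℚ N) ^ s).natDegree : ℕ) : ℤ) ≤
      p.natDegree + s * N := by exact_mod_cast h1.trans (by omega)
    push_cast
    linarith
  · have h1 := ascPochhammer_eval_ne_zero N k
    rw [hg, eval_mul, eval_pow, pow_add, mul_div_mul_right _ _ (pow_ne_zero _ h1)]

lemma mul_mem {t t' : ℕ} {D D' : ℤ} {f g : ℕ → ℚ} (hf : f ∈ ratFun t D) (hg : g ∈ ratFun t' D') :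
    f * g ∈ ratFun (t + t') (D + D') := by
  induction hf using Submodule.span_induction with
  | zero => rw [zero_mul]; exact zero_mem _
  | add x y _ _ hx hy => rw [add_mul]; exact add_mem hx hy
  | smul a x _ hx => rw [smul_mul_assoc]; exact Submodule.smul_mem _ _ hx
  | mem f hf =>
    induction hg using Submodule.span_induction with
    | zero => rw [mul_zero]; exact zero_mem _
    | add x y _ _ hx hy => rw [mul_add]; exact add_mem hx hy
    | smul a x _ hx => rw [mul_smul_comm]; exact Submodule.smul_mem _ _ hx
    | mem g hg =>
      obtain ⟨N, p, hp, hf⟩ := hf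
      obtain ⟨M, q, hq, hg⟩ := hg
      obtain ⟨p', hp', hf'⟩ := exists_larger hp M
      obtain ⟨q', hq', hg'⟩ := exists_larger hq N
      refine mem_of_natDegree_le (N := N + M) (p := p' * q') ?_ fun k => ?_
      · have h1 : (((p' * q').natDegree : ℕ) : ℤ) ≤ p'.natDegree + q'.natDegree := by
          exact_mod_cast natDegree_mul_le
        push_cast at *
        linarith
      · rw [Pi.mul_apply, hf, hg, hf', hg', add_comm M N, eval_mul, pow_add, div_mul_div_comm]

lemma eval_ascPochhammer_succ (N k : ℕ) :
    (ascPochhammer ℚ (N + 1)).eval ((k : ℚ) + 1) =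
      ((k : ℚ) + 1) * (ascPochhammer ℚ N).eval ((k : ℚ) + 1 + 1) := by
  rw [ascPochhammer_succ_left]
  simp [eval_comp]

lemma shift_mem {t : ℕ} {D : ℤ} {f : ℕ → ℚ} (hf : f ∈ ratFun t D) :
    (fun k => f (k + 1)) ∈ ratFun t D := by
  induction hf using Submodule.span_induction with
  | zero => exact zero_mem _
  | add x y _ _ hx hy => exact add_mem hx hy
  | smul a x _ hx => exact Submodule.smul_mem _ a hx
  | mem f hf =>
    obtain ⟨N, p, hp, hf⟩ := hf
    refine mem_of_natDegree_le (N := N + 1) (p := p.comp (X + C 1) * X ^ t) ?_ fun k => ?_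
    · have h1 := natDegree_mul_le (p := p.comp (X + C 1)) (q := X ^ t)
      rw [natDegree_comp, natDegree_X_add_C, natDegree_X_pow] at h1
      have h3 : (((p.comp (X + C 1) * X ^ t).natDegree : ℕ) : ℤ) ≤ p.natDegree + t := by
        exact_mod_cast h1.trans (by omega)
      push_cast
      linarith
    · have h1 : ((k : ℚ) + 1) ≠ 0 := by positivity
      rw [hf, eval_ascPochhammer_succ, mul_pow]
      simp only [eval_mul, eval_comp, eval_add, eval_X, eval_C, eval_pow, Nat.cast_add,
        Nat.cast_one]
      rw [mul_comm (((k : ℚ) + 1) ^ t), mul_div_mul_right _ _ (pow_ne_zero _ h1)]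

lemma inv_pow_mem (s : ℕ) : (fun k : ℕ => (((k : ℚ) + 1) ^ s)⁻¹) ∈ ratFun s (-s) :=
  mem_of_natDegree_le (N := 1) (p := 1) (by simp) fun k => by simp

lemma polynomial_mem {p : ℚ[X]} {D : ℤ} (t : ℕ) (hp : (p.natDegree : ℤ) ≤ D) :
    (fun k : ℕ => p.eval ((k : ℚ) + 1)) ∈ ratFun t D :=
  mem_of_natDegree_le (N := 0) (p := p) (by simpa using hp) fun k => by simp

lemma pow_le_ascPochhammer_eval (N k : ℕ) :
    ((k : ℚ) + 1) ^ N ≤ (ascPochhammer ℚ N).eval ((k : ℚ) + 1) := by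
  induction N with
  | zero => simp
  | succ N ih =>
    rw [ascPochhammer_succ_eval, pow_succ]
    exact mul_le_mul ih (by linarith [(Nat.cast_nonneg N : (0 : ℚ) ≤ N)]) (by positivity)
      (ascPochhammer_pos N _ (by positivity)).le

lemma exists_bound {t : ℕ} {f : ℕ → ℚ} (hf : f ∈ ratFun t (-1)) :
    ∃ C : ℚ, 0 ≤ C ∧ ∀ k : ℕ, |f k| ≤ C / ((k : ℚ) + 1) := by
  induction hf using Submodule.span_induction with
  | zero => exact ⟨0, le_rfl, fun k => by simp⟩
  | add x y _ _ hx hy =>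
    obtain ⟨a, ha, hx⟩ := hx
    obtain ⟨b, hb, hy⟩ := hy
    exact ⟨a + b, by positivity, fun k => by
      rw [add_div]; exact (abs_add_le _ _).trans (add_le_add (hx k) (hy k))⟩
  | smul c x _ hx =>
    obtain ⟨a, ha, hx⟩ := hx
    exact ⟨|c| * a, by positivity, fun k => by
      rw [mul_div_assoc, Pi.smul_apply, smul_eq_mul, abs_mul]
      exact mul_le_mul_of_nonneg_left (hx k) (abs_nonneg _)⟩
  | mem f hf =>
    obtain ⟨N, p, hp, hf⟩ := hf
    refine ⟨∑ i ∈ Finset.range (p.natDegree + 1), |p.coeff i|,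
      Finset.sum_nonneg fun _ _ => abs_nonneg _, fun k => ?_⟩
    have hx : (1 : ℚ) ≤ (k : ℚ) + 1 := by linarith [(Nat.cast_nonneg k : (0 : ℚ) ≤ k)]
    have hx0 : (0 : ℚ) < (k : ℚ) + 1 := by positivity
    have hpos := ascPochhammer_pos N ((k : ℚ) + 1) hx0
    have hN : ((k : ℚ) + 1) ^ (p.natDegree + 1) ≤ ((ascPochhammer ℚ N).eval ((k : ℚ) + 1)) ^ t := by
      calc ((k : ℚ) + 1) ^ (p.natDegree + 1) ≤ ((k : ℚ) + 1) ^ (N * t) :=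
            pow_le_pow_right₀ hx (by zify; linarith)
        _ = (((k : ℚ) + 1) ^ N) ^ t := pow_mul _ _ _
        _ ≤ _ := pow_le_pow_left₀ (by positivity) (pow_le_ascPochhammer_eval N k) _
    have hP : |p.eval ((k : ℚ) + 1)| ≤
        (∑ i ∈ Finset.range (p.natDegree + 1), |p.coeff i|) * ((k : ℚ) + 1) ^ p.natDegree := by
      rw [eval_eq_sum_range, Finset.sum_mul]
      refine (Finset.abs_sum_le_sum_abs _ _).trans (Finset.sum_le_sum fun i hi => ?_)
      rw [abs_mul, abs_of_nonneg (pow_nonneg hx0.le i)]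
      exact mul_le_mul_of_nonneg_left
        (pow_le_pow_right₀ hx (Nat.lt_succ_iff.1 (Finset.mem_range.1 hi))) (abs_nonneg _)
    rw [hf, abs_div, abs_of_pos (pow_pos hpos t), div_le_div_iff₀ (pow_pos hpos t) hx0]
    calc |p.eval ((k : ℚ) + 1)| * ((k : ℚ) + 1)
        ≤ (∑ i ∈ Finset.range (p.natDegree + 1), |p.coeff i|) * ((k : ℚ) + 1) ^ p.natDegree *
          ((k : ℚ) + 1) := mul_le_mul_of_nonneg_right hP hx0.le
      _ = (∑ i ∈ Finset.range (p.natDegree + 1), |p.coeff i|) *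
          ((k : ℚ) + 1) ^ (p.natDegree + 1) := by rw [pow_succ, mul_assoc]
      _ ≤ _ := mul_le_mul_of_nonneg_left hN (Finset.sum_nonneg fun _ _ => abs_nonneg _)

/-- A function of degree at most `-1` has a forward difference of degree at most `-2`. -/
lemma difference_mem {t : ℕ} {f : ℕ → ℚ} (hf : f ∈ ratFun t (-1)) :
    (fun k => f (k + 1) - f k) ∈ ratFun t (-2) := by
  induction hf using Submodule.span_induction with
  | zero =>
    simp only [Pi.zero_apply, sub_self]
    exact zero_mem _
  | add x y _ _ hx hy =>
    convert add_mem hx hy using 1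
    ext k
    simp only [Pi.add_apply]
    ring
  | smul a x _ hx =>
    convert Submodule.smul_mem _ a hx using 1
    ext k
    simp only [Pi.smul_apply, smul_eq_mul]
    ring
  | mem f hf =>
    obtain ⟨N, p, hp, hf⟩ := hf
    by_cases h0 : p = 0
    · simp only [hf, h0, eval_zero, zero_div, sub_self]
      exact zero_mem _
    have hc0 : p.comp (X + C 1) ≠ 0 := by
      rw [Ne, comp_eq_zero_iff]
      rintro (h | ⟨-, h⟩)
      · exact h0 h
      · have := congrArg natDegree h
        rw [natDegree_X_add_C, natDegree_C] at this
        exact one_ne_zero this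
    have d1 : (p.comp (X + C 1) * X ^ t).degree = ((p.natDegree + t : ℕ) : WithBot ℕ) := by
      rw [degree_mul, degree_eq_natDegree hc0, natDegree_comp, natDegree_X_add_C, degree_X_pow]
      simp
    have d2 : (p * (X + C (N : ℚ)) ^ t).degree = ((p.natDegree + t : ℕ) : WithBot ℕ) := by
      rw [degree_mul, degree_eq_natDegree h0, degree_pow, degree_X_add_C]
      simp
    have hlt := degree_sub_lt_left (d1.trans d2.symm)
      (mul_ne_zero hc0 (pow_ne_zero _ X_ne_zero)) (by
        rw [leadingCoeff_mul, leadingCoeff_mul,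
          leadingCoeff_comp (by rw [natDegree_X_add_C]; exact one_ne_zero),
          leadingCoeff_pow, leadingCoeff_pow, leadingCoeff_X_add_C, leadingCoeff_X_add_C,
          leadingCoeff_X]
        simp)
    rw [d1] at hlt
    refine mem_of_degree_lt (N := N + 1) hlt (by push_cast; linarith) fun k => ?_
    have h1 : ((k : ℚ) + 1) ≠ 0 := by positivity
    have h2 := ascPochhammer_eval_ne_zero N k
    have h3 := ascPochhammer_eval_ne_zero (N + 1) k
    have h4 := ascPochhammer_eval_ne_zero N (k + 1)
    push_cast at h4
    rw [hf, hf, eval_sub, sub_div, eval_mul, eval_mul]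
    congr 1
    · rw [eval_ascPochhammer_succ, mul_pow]
      simp only [eval_comp, eval_add, eval_X, eval_C, eval_pow, Nat.cast_add,
        Nat.cast_one]
      rw [mul_comm (((k : ℚ) + 1) ^ t), mul_div_mul_right _ _ (pow_ne_zero _ h1)]
    · have h5 : ((k : ℚ) + 1 + N) ≠ 0 := by positivity
      rw [ascPochhammer_succ_eval, mul_pow, eval_pow, eval_add, eval_X, eval_C,
        mul_div_mul_right _ _ (pow_ne_zero _ h5)]

lemma exists_antidifference (q : ℚ[X]) :
    ∃ Q : ℚ[X], Q.natDegree ≤ q.natDegree + 1 ∧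
      ∀ x : ℚ, q.eval x = Q.eval (x + 1) - Q.eval x := by
  refine ⟨∑ i ∈ Finset.range (q.natDegree + 1),
    C (q.coeff i / ((i : ℚ) + 1)) * Polynomial.bernoulli (i + 1), ?_, fun x => ?_⟩
  · refine natDegree_sum_le_of_forall_le _ _ fun i hi => (natDegree_C_mul_le _ _).trans ?_
    refine natDegree_le_iff_coeff_eq_zero.2 fun m hm => ?_
    rw [coeff_bernoulli, if_neg]
    have := Finset.mem_range.1 hi
    omega
  · rw [eval_finsetSum, eval_finsetSum, ← Finset.sum_sub_distrib, eval_eq_sum_range]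
    refine Finset.sum_congr rfl fun i _ => ?_
    have h := Polynomial.bernoulli_eval_one_add (i + 1) x
    have hi : (i : ℚ) + 1 ≠ 0 := by positivity
    rw [eval_mul, eval_mul, eval_C, eval_C, add_comm x 1, h]
    push_cast
    field_simp
    ring

end ratFun

namespace ratFun

open Polynomial

lemma exists_mul_add_mul_eq {P Q p : ℚ[X]} (hP : P.Monic) (hQ : Q.Monic) (h : IsCoprime P Q)
    (hp : p.degree < P.degree + Q.degree) :
    ∃ a b : ℚ[X], a.degree < P.degree ∧ b.degree < Q.degree ∧ p = a * Q + b * P := by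
  obtain ⟨u, v, huv⟩ := h
  have hb := degree_modByMonic_lt (p * u) hQ
  have e : p = (p * v + P * (p * u /ₘ Q)) * Q + (p * u %ₘ Q) * P := by
    have h1 := modByMonic_add_div (p * u) Q
    linear_combination (-p) * huv - P * h1
  refine ⟨p * v + P * (p * u /ₘ Q), p * u %ₘ Q, ?_, hb, e⟩
  by_contra hcon
  push Not at hcon
  have h2 : ((p * v + P * (p * u /ₘ Q)) * Q).degree < P.degree + Q.degree := by
    rw [eq_sub_iff_add_eq.2 e.symm]
    refine (degree_sub_le _ _).trans_lt (max_lt hp ?_)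
    rw [degree_mul, add_comm P.degree]
    exact WithBot.add_lt_add_right (degree_ne_bot.2 hP.ne_zero) hb
  rw [degree_mul] at h2
  exact absurd h2 (not_lt.2 (by gcongr))

lemma isCoprime_ascPochhammer (N : ℕ) :
    IsCoprime (ascPochhammer ℚ N) (X + C (N : ℚ)) := by
  have h := (irreducible_X_sub_C (-(N : ℚ))).coprime_iff_not_dvd (n := ascPochhammer ℚ N)
  rw [C_neg, sub_neg_eq_add] at h
  refine (h.2 fun hd => ?_).symm
  rw [← sub_neg_eq_add, ← C_neg, dvd_iff_isRoot, IsRoot, ascPochhammer_eval_eq_zero_iff] at hd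
  obtain ⟨k, hk, hk'⟩ := hd
  rw [neg_neg] at hk'
  exact hk.ne (by exact_mod_cast hk')

lemma degree_ascPochhammer_pow (N t : ℕ) :
    ((ascPochhammer ℚ N) ^ t).degree = ((N * t : ℕ) : WithBot ℕ) := by
  rw [degree_pow, degree_eq_natDegree (monic_ascPochhammer ℚ N).ne_zero, ascPochhammer_natDegree]
  simp [mul_comm]

/-- A proper fraction is a combination of powers of `1 / x` up to a forward difference. -/
lemma exists_decomposition_of_degree_lt (t N : ℕ) (p : ℚ[X])
    (hp : p.degree < ((N * t : ℕ) : WithBot ℕ)) :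
    ∃ (c : ℕ → ℚ) (G : ℕ → ℚ), G ∈ ratFun t (-1) ∧ ∀ k : ℕ,
      p.eval ((k : ℚ) + 1) / ((ascPochhammer ℚ N).eval ((k : ℚ) + 1)) ^ t =
        ∑ u ∈ Finset.Icc 1 t, c u * (((k : ℚ) + 1) ^ u)⁻¹ + (G (k + 1) - G k) := by
  induction N generalizing p with
  | zero =>
    have h0 : p = 0 := by
      rw [← degree_eq_bot]
      simpa using hp
    exact ⟨0, 0, zero_mem _, fun k => by simp [h0]⟩
  | succ N ih =>
    rcases Nat.eq_zero_or_pos N with rfl | hN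
    · rcases eq_or_ne p 0 with rfl | h0
      · exact ⟨0, 0, zero_mem _, fun k => by simp⟩
      refine ⟨fun u => p.coeff (t - u), 0, zero_mem _, fun k => ?_⟩
      have hx : ((k : ℚ) + 1) ≠ 0 := by positivity
      rw [zero_add, one_mul] at hp
      rw [eval_eq_sum_range' ((natDegree_lt_iff_degree_lt h0).2 hp), zero_add, ascPochhammer_one,
        eval_X, Finset.sum_div, Pi.zero_apply, Pi.zero_apply, sub_zero, add_zero]
      refine Finset.sum_nbij' (fun i => t - i) (fun u => t - u) ?_ ?_ ?_ ?_ ?_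
      · intro i hi
        rw [Finset.mem_range] at hi
        rw [Finset.mem_Icc]
        omega
      · intro u hu
        rw [Finset.mem_Icc] at hu
        rw [Finset.mem_range]
        omega
      · intro i hi
        rw [Finset.mem_range] at hi
        omega
      · intro u hu
        rw [Finset.mem_Icc] at hu
        omega
      · intro i hi
        rw [Finset.mem_range] at hi
        obtain ⟨j, rfl⟩ := Nat.exists_eq_add_of_lt hi
        beta_reduce
        rw [show i + j + 1 - (i + j + 1 - i) = i by omega,
          show i + j + 1 - i = j + 1 by omega]
        field_simp
        ring
    · have hM : ((ascPochhammer ℚ N) ^ t).Monic := (monic_ascPochhammer ℚ N).pow t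
      have hQ : ((X + C (N : ℚ)) ^ t).Monic := (monic_X_add_C _).pow t
      have hdQ : ((X + C (N : ℚ)) ^ t).degree = ((t : ℕ) : WithBot ℕ) := by
        rw [degree_pow, degree_X_add_C]; simp
      obtain ⟨a, b, ha, hb, rfl⟩ := exists_mul_add_mul_eq hM hQ (isCoprime_ascPochhammer N).pow
        (p := p) (by
          rw [degree_ascPochhammer_pow, hdQ]
          exact hp.trans_le (by rw [← Nat.cast_add, Nat.succ_mul]))
      obtain ⟨M, rfl⟩ : ∃ M, N = M + 1 := ⟨N - 1, by omega⟩
      set b' : ℚ[X] := b.comp (X + C (-1)) * (ascPochhammer ℚ M) ^ t with hb'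
      have hdb : b'.degree < (((M + 1) * t : ℕ) : WithBot ℕ) := by
        by_cases h0 : b = 0
        · rw [hb', h0, zero_comp, zero_mul, degree_zero]
          exact WithBot.bot_lt_coe _
        rw [hdQ] at hb
        have h1 : b.natDegree < t := (natDegree_lt_iff_degree_lt h0).2 hb
        have h2 := natDegree_mul_le (p := b.comp (X + C (-1))) (q := (ascPochhammer ℚ M) ^ t)
        rw [natDegree_comp, natDegree_X_add_C, natDegree_pow, ascPochhammer_natDegree] at h2
        refine (degree_le_natDegree).trans_lt ?_
        rw [Nat.cast_lt]
        refine h2.trans_lt ?_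
        nlinarith
      rw [degree_ascPochhammer_pow] at ha
      obtain ⟨c, G, hG, h⟩ := ih (a + b') ((degree_add_le _ _).trans_lt (max_lt ha hdb))
      set G0 : ℕ → ℚ := fun k =>
        b'.eval ((k : ℚ) + 1) / ((ascPochhammer ℚ (M + 1)).eval ((k : ℚ) + 1)) ^ t with hG0
      have hG0m : G0 ∈ ratFun t (-1) :=
        mem_of_degree_lt hdb (by push_cast; linarith) fun k => rfl
      refine ⟨c, G + G0, add_mem hG hG0m, fun k => ?_⟩
      have h1 := ascPochhammer_eval_ne_zero (M + 1) k
      have h2 := ascPochhammer_eval_ne_zero M (k + 1)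
      have h3 : ((k : ℚ) + 1 + (M + 1 : ℕ)) ≠ 0 := by positivity
      have h4 : G0 (k + 1) = b.eval ((k : ℚ) + 1) / ((k : ℚ) + 1 + (M + 1 : ℕ)) ^ t := by
        simp only [hG0, hb']
        rw [ascPochhammer_succ_eval, mul_pow, eval_mul, eval_pow, mul_comm (b.comp _ |>.eval _),
          mul_div_mul_left _ _ (pow_ne_zero _ h2)]
        simp only [eval_comp, eval_add, eval_X, eval_C]
        push_cast
        congr 2 <;> ring
      have h5 := h k
      rw [eval_add, add_div] at h5
      rw [Pi.add_apply, Pi.add_apply, h4, ascPochhammer_succ_eval, mul_pow]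
      simp only [eval_add, eval_mul, eval_pow, eval_X, eval_C]
      have h6 : G0 k = b'.eval ((k : ℚ) + 1) /
        ((ascPochhammer ℚ (M + 1)).eval ((k : ℚ) + 1)) ^ t := rfl
      rw [add_div, mul_div_mul_right _ _ (pow_ne_zero _ h3), mul_comm (b.eval _),
        mul_div_mul_left _ _ (pow_ne_zero _ h1), h6]
      linarith

/-- Every rational function of degree at most `D ≥ -2` is a combination of powers of `1 / x` up to
a forward difference, and `1 / x` itself is not needed when `D = -2`. -/
lemma exists_decomposition {t : ℕ} {D : ℤ} (hD : -2 ≤ D) {f : ℕ → ℚ} (hf : f ∈ ratFun t D) :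
    ∃ (c : ℕ → ℚ) (G : ℕ → ℚ), G ∈ ratFun t (D + 1) ∧ (D = -2 → c 1 = 0) ∧ ∀ k : ℕ,
      f k = ∑ u ∈ Finset.Icc 1 t, c u * (((k : ℚ) + 1) ^ u)⁻¹ + (G (k + 1) - G k) := by
  have main : ∃ (c : ℕ → ℚ) (G : ℕ → ℚ), G ∈ ratFun t (D + 1) ∧ ∀ k : ℕ,
      f k = ∑ u ∈ Finset.Icc 1 t, c u * (((k : ℚ) + 1) ^ u)⁻¹ + (G (k + 1) - G k) := by
    induction hf using Submodule.span_induction with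
    | zero => exact ⟨0, 0, zero_mem _, fun k => by simp⟩
    | add x y _ _ hx hy =>
      obtain ⟨c, G, hG, hx⟩ := hx
      obtain ⟨c', G', hG', hy⟩ := hy
      refine ⟨c + c', G + G', add_mem hG hG', fun k => ?_⟩
      simp only [Pi.add_apply, hx, hy, add_mul, Finset.sum_add_distrib]
      ring
    | smul a x _ hx =>
      obtain ⟨c, G, hG, hx⟩ := hx
      refine ⟨a • c, a • G, Submodule.smul_mem _ _ hG, fun k => ?_⟩
      simp only [Pi.smul_apply, smul_eq_mul, hx, mul_add, Finset.mul_sum, mul_assoc]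
      ring
    | mem f hf =>
      obtain ⟨N, p, hp, hf⟩ := hf
      have hM : ((ascPochhammer ℚ N) ^ t).Monic := (monic_ascPochhammer ℚ N).pow t
      have hr := degree_modByMonic_lt p hM
      rw [degree_ascPochhammer_pow] at hr
      obtain ⟨c, G, hG, h⟩ := exists_decomposition_of_degree_lt t N _ hr
      obtain ⟨Q, hQd, hQ⟩ := exists_antidifference (p /ₘ (ascPochhammer ℚ N) ^ t)
      have hq : (p /ₘ (ascPochhammer ℚ N) ^ t).natDegree = p.natDegree - N * t := by
        rw [natDegree_divByMonic _ hM, natDegree_pow, ascPochhammer_natDegree, mul_comm]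
      have hsplit : ∀ k : ℕ, f k = (p /ₘ (ascPochhammer ℚ N) ^ t).eval ((k : ℚ) + 1) +
          (∑ u ∈ Finset.Icc 1 t, c u * (((k : ℚ) + 1) ^ u)⁻¹ + (G (k + 1) - G k)) := fun k => by
        have h1 := pow_ne_zero t (ascPochhammer_eval_ne_zero N k)
        rw [← h k, hf]
        conv_lhs => rw [← modByMonic_add_div p ((ascPochhammer ℚ N) ^ t)]
        rw [eval_add, eval_mul, eval_pow, add_div, mul_div_cancel_left₀ _ h1, add_comm]
      rcases lt_or_ge D 0 with hD0 | hD0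
      · refine ⟨c, G, mono le_rfl (by omega) hG, fun k => ?_⟩
        have h0 : p /ₘ (ascPochhammer ℚ N) ^ t = 0 := by
          rw [divByMonic_eq_zero_iff hM, degree_ascPochhammer_pow]
          refine degree_le_natDegree.trans_lt ?_
          rw [Nat.cast_lt]
          zify
          linarith
        rw [hsplit, h0, eval_zero, zero_add]
      · refine ⟨c, G + fun k : ℕ => Q.eval ((k : ℚ) + 1),
          add_mem (mono le_rfl (by omega) hG) (polynomial_mem t ?_), fun k => ?_⟩
        · have : ((N * t : ℕ) : ℤ) = N * t := by push_cast; ring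
          omega
        · rw [hsplit, hQ]
          simp only [Pi.add_apply]
          push_cast
          ring
  obtain ⟨c, G, hG, h⟩ := main
  by_cases hc : D = -2 ∧ 1 ≤ t
  · refine ⟨c, G, hG, fun _ => ?_, h⟩
    obtain ⟨rfl, ht⟩ := hc
    have h1 : (fun k : ℕ => c 1 * ((k : ℚ) + 1)⁻¹) ∈ ratFun t (-2) := by
      have h2 : (fun k : ℕ => ∑ u ∈ Finset.Icc 2 t, c u * (((k : ℚ) + 1) ^ u)⁻¹) ∈
          ratFun t (-2) := by
        have h3 : ∑ u ∈ Finset.Icc 2 t, c u • (fun k : ℕ => (((k : ℚ) + 1) ^ u)⁻¹) ∈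
            ratFun t (-2) := sum_mem fun u hu => by
          rw [Finset.mem_Icc] at hu
          exact Submodule.smul_mem _ _ (mono hu.2 (by omega) (inv_pow_mem u))
        convert h3 using 1
        ext k
        simp
      convert sub_mem (sub_mem hf (difference_mem hG)) h2 using 1
      ext k
      simp only [Pi.sub_apply]
      rw [h k, ← Finset.add_sum_Ioc_eq_sum_Icc ht, pow_one]
      have : Finset.Ioc 1 t = Finset.Icc 2 t := by ext; simp [Nat.succ_le_iff]
      rw [this]
      ring
    have h2 := mul_mem (polynomial_mem (p := X) (D := 1) 0 (by simp)) h1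
    rw [zero_add, show (1 : ℤ) + -2 = -1 by norm_num] at h2
    obtain ⟨C, hC0, hC⟩ := exists_bound h2
    by_contra hc1
    obtain ⟨k, hk⟩ := exists_nat_gt (C / |c 1|)
    have h3 := hC k
    have hx : (0 : ℚ) < (k : ℚ) + 1 := by positivity
    rw [div_lt_iff₀ (abs_pos.2 hc1)] at hk
    simp only [Pi.mul_apply, eval_X] at h3
    rw [mul_left_comm, mul_inv_cancel₀ hx.ne', mul_one, le_div_iff₀ hx] at h3
    nlinarith [abs_nonneg (c 1)]
  · refine ⟨fun u => if u = 1 ∧ D = -2 then 0 else c u, G, hG, fun h => by simp [h], fun k => ?_⟩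
    rw [h k]
    congr 1
    refine Finset.sum_congr rfl fun u hu => ?_
    rw [Finset.mem_Icc] at hu
    have : ¬(u = 1 ∧ D = -2) := by
      rintro ⟨rfl, h⟩
      exact hc ⟨h, hu.2⟩
    simp only [this, if_false]

end ratFun

/-- The truncation of `mzv s` to tuples of integers at most `k`. -/
def harmonicSum : List ℕ → ℕ → ℚ
  | [], _ => 1
  | a :: s, k => ∑ m ∈ Finset.range k, (((m : ℚ) + 1) ^ a)⁻¹ * harmonicSum s m

lemma harmonicSum_cons_succ (a : ℕ) (s : List ℕ) (k : ℕ) :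
    harmonicSum (a :: s) (k + 1) =
      harmonicSum (a :: s) k + (((k : ℚ) + 1) ^ a)⁻¹ * harmonicSum s k :=
  Finset.sum_range_succ _ _

/-- `IsAdmissible L t s` says that `L` splits into consecutive blocks, the first of which may be
empty and has sum at least `t`, while the others are non-empty and their sums are at least the
corresponding (positive) entries of `s`. -/
inductive IsAdmissible : List ℕ → ℕ → List ℕ → Prop
  | nil : IsAdmissible [] 0 []
  | extend {L : List ℕ} {a t t' : ℕ} {s : List ℕ} :
      IsAdmissible L t s → t' ≤ a + t → IsAdmissible (a :: L) t' s
  | close {L : List ℕ} {t : ℕ} {s : List ℕ} :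
      IsAdmissible L t s → 1 ≤ t → IsAdmissible L 0 (t :: s)

namespace IsAdmissible

lemma nil_right (L : List ℕ) : IsAdmissible L 0 [] := by
  induction L with
  | nil => exact nil
  | cons a L ih => exact extend ih (Nat.zero_le _)

lemma mono {L : List ℕ} {t t' : ℕ} {s : List ℕ} (h : IsAdmissible L t s) (ht : t' ≤ t) :
    IsAdmissible L t' s := by
  cases h with
  | nil => rw [Nat.le_zero.1 ht]; exact nil
  | extend h h' => exact extend h (ht.trans h')
  | close h h' => rw [Nat.le_zero.1 ht]; exact close h h'

lemma merge {L : List ℕ} {t a : ℕ} {s : List ℕ} (h : IsAdmissible L t (a :: s)) :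
    IsAdmissible L (t + a) s := by
  generalize hs : a :: s = s' at h
  induction h with
  | nil => cases hs
  | extend _ h' ih => exact extend (ih hs) (by omega)
  | close h _ => cases hs; rwa [zero_add]

lemma one_le_of_mem {L : List ℕ} {t : ℕ} {s : List ℕ} (h : IsAdmissible L t s) :
    ∀ a ∈ s, 1 ≤ a := by
  induction h with
  | nil => simp
  | extend _ _ ih => exact ih
  | close _ h ih => simpa using ⟨h, ih⟩

lemma add_sum_le {L : List ℕ} {t : ℕ} {s : List ℕ} (h : IsAdmissible L t s) :
    t + s.sum ≤ L.sum := by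
  induction h with
  | nil => simp
  | extend _ h ih => rw [List.sum_cons]; omega
  | close _ h ih => rw [List.sum_cons]; omega

/-- The positions of the block boundaries of an admissible triple. -/
lemma exists_blocks {L : List ℕ} {t : ℕ} {s : List ℕ} (h : IsAdmissible L t s) :
    ∃ ℓ : ℕ → ℕ, ℓ s.length = L.length ∧ StrictMonoOn ℓ (Set.Iic s.length) ∧
      t ≤ ∑ i ∈ Finset.Ico 0 (ℓ 0), L.getD i 0 ∧
      ∀ j : Fin s.length, s.get j ≤ ∑ i ∈ Finset.Ico (ℓ j.1) (ℓ (j.1 + 1)), L.getD i 0 := by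
  induction h with
  | nil =>
    refine ⟨fun _ => 0, rfl, ?_, by simp, fun j => j.elim0⟩
    intro x hx y hy hxy
    simp only [List.length_nil, Set.mem_Iic] at hx hy
    omega
  | @extend L a t t' s _ h ih =>
    obtain ⟨ℓ, h1, h2, h3, h4⟩ := ih
    refine ⟨fun j => ℓ j + 1, by simp [h1], fun x hx y hy hxy =>
      Nat.succ_lt_succ (h2 hx hy hxy), ?_, fun j => ?_⟩
    · rw [Finset.sum_eq_sum_Ico_succ_bot (Nat.succ_pos _)]
      rw [← Finset.sum_Ico_add' (fun i => (a :: L).getD i 0) 0 (ℓ 0) 1]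
      simp only [List.getD_cons_zero, List.getD_cons_succ]
      omega
    · rw [← Finset.sum_Ico_add' (fun i => (a :: L).getD i 0) (ℓ j.1) (ℓ (j.1 + 1)) 1]
      simpa only [List.getD_cons_succ] using h4 j
  | @close L t s _ h ih =>
    obtain ⟨ℓ, h1, h2, h3, h4⟩ := ih
    have h0 : 0 < ℓ 0 := by
      by_contra h0
      rw [Nat.eq_zero_of_not_pos h0] at h3
      simp at h3
      omega
    refine ⟨fun j => Nat.casesOn j 0 ℓ, h1, ?_, by simp, fun j => ?_⟩
    · intro x hx y hy hxy
      rw [Set.mem_Iic, List.length_cons] at hx hy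
      obtain ⟨y, rfl⟩ : ∃ y', y = y' + 1 := ⟨y - 1, by omega⟩
      have hle : ℓ 0 ≤ ℓ y :=
        h2.monotoneOn (Set.mem_Iic.2 (Nat.zero_le _)) (Set.mem_Iic.2 (by omega)) (Nat.zero_le _)
      cases x with
      | zero => exact h0.trans_le hle
      | succ x => exact h2 (Set.mem_Iic.2 (by omega)) (Set.mem_Iic.2 (by omega)) (by omega)
    · refine Fin.cases ?_ (fun j => ?_) j
      · exact h3
      · exact h4 j

lemma length_le {L : List ℕ} {t : ℕ} {s : List ℕ} (h : IsAdmissible L t s) :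
    s.length ≤ L.length := by
  obtain ⟨ℓ, h1, h2, -, -⟩ := h.exists_blocks
  rw [← h1]
  have : ∀ j, j ≤ s.length → j ≤ ℓ j := fun j hj => by
    induction j with
    | zero => exact Nat.zero_le _
    | succ j ih =>
      have := h2 (Set.mem_Iic.2 (by omega)) (Set.mem_Iic.2 hj) (Nat.lt_succ_self j)
      have := ih (by omega)
      omega
  exact this _ le_rfl

end IsAdmissible

/-- The span of the products of a truncated multiple zeta value by a rational function of degree
at most `D`, the orders of the poles being compatible with `L`. -/
def harmonicSpan (L : List ℕ) (D : ℤ) : Submodule ℚ (ℕ → ℚ) :=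
  Submodule.span ℚ {f | ∃ (t : ℕ) (s : List ℕ) (g : ℕ → ℚ), IsAdmissible L t s ∧ g ∈ ratFun t D ∧
    f = g * harmonicSum s}

/-- The exponents of the convergent multiple zeta values compatible with `L`. -/
def convergentExponents (L : List ℕ) : Set (List ℕ) :=
  {s | IsAdmissible L 0 s ∧ (s ≠ [] → 2 ≤ s.headI)}

namespace harmonicSpan

lemma mul_mem_of_isAdmissible {L : List ℕ} {t : ℕ} {s : List ℕ} {D : ℤ} {g : ℕ → ℚ}
    (h : IsAdmissible L t s) (hg : g ∈ ratFun t D) : g * harmonicSum s ∈ harmonicSpan L D :=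
  Submodule.subset_span ⟨t, s, g, h, hg, rfl⟩

lemma harmonicSum_mem {L : List ℕ} {s : List ℕ} {D : ℤ} (hD : 0 ≤ D) (h : IsAdmissible L 0 s) :
    harmonicSum s ∈ harmonicSpan L D := by
  have h1 : (fun _ => 1 : ℕ → ℚ) ∈ ratFun 0 D := by
    simpa using ratFun.polynomial_mem (p := 1) (D := D) 0 (by simpa using hD)
  convert mul_mem_of_isAdmissible h h1 using 1
  ext k
  simp

lemma mul_mem {L : List ℕ} {a : ℕ} {D E : ℤ} {g f : ℕ → ℚ} (hg : g ∈ ratFun a E)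
    (hf : f ∈ harmonicSpan L D) : g * f ∈ harmonicSpan (a :: L) (E + D) := by
  induction hf using Submodule.span_induction with
  | zero => rw [mul_zero]; exact zero_mem _
  | add x y _ _ hx hy => rw [mul_add]; exact add_mem hx hy
  | smul c x _ hx => rw [mul_smul_comm]; exact Submodule.smul_mem _ _ hx
  | mem f hf =>
    obtain ⟨t, s, f, hs, hf, rfl⟩ := hf
    rw [← mul_assoc]
    exact mul_mem_of_isAdmissible (hs.extend le_rfl) (ratFun.mul_mem hg hf)

lemma shift_mem {L : List ℕ} {D : ℤ} {f : ℕ → ℚ} (hf : f ∈ harmonicSpan L D) :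
    (fun k => f (k + 1)) ∈ harmonicSpan L D := by
  induction hf using Submodule.span_induction with
  | zero => exact zero_mem _
  | add x y _ _ hx hy => exact add_mem hx hy
  | smul c x _ hx => exact Submodule.smul_mem _ c hx
  | mem f hf =>
    obtain ⟨t, s, g, hs, hg, rfl⟩ := hf
    have hg' := ratFun.shift_mem hg
    cases s with
    | nil => exact mul_mem_of_isAdmissible hs hg'
    | cons a s =>
      have h1 := mul_mem_of_isAdmissible hs.merge
        (ratFun.mono le_rfl (by omega : D + -(a : ℤ) ≤ D)
          (ratFun.mul_mem hg' (ratFun.inv_pow_mem a)))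
      convert add_mem (mul_mem_of_isAdmissible hs hg') h1 using 1
      ext k
      simp only [Pi.mul_apply, Pi.add_apply, harmonicSum_cons_succ]
      ring

/-- Summation by parts. -/
lemma sum_mul_harmonicSum_eq (c : ℕ → ℚ) (T : Finset ℕ) (g G : ℕ → ℚ) (s : List ℕ)
    (hg : ∀ k : ℕ, g k = ∑ u ∈ T, c u * (((k : ℚ) + 1) ^ u)⁻¹ + (G (k + 1) - G k)) (k : ℕ) :
    ∑ m ∈ Finset.range k, g m * harmonicSum s m =
      ∑ u ∈ T, c u * harmonicSum (u :: s) k + G k * harmonicSum s k - G 0 * harmonicSum s 0 -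
        ∑ m ∈ Finset.range k, G (m + 1) * (harmonicSum s (m + 1) - harmonicSum s m) := by
  induction k with
  | zero => simp [harmonicSum]
  | succ k ih =>
    rw [Finset.sum_range_succ, Finset.sum_range_succ, ih, hg k]
    simp only [harmonicSum_cons_succ, mul_add, Finset.sum_add_distrib, add_mul, Finset.sum_mul,
      mul_assoc]
    ring

lemma sum_mul_harmonicSum_mem {L : List ℕ} {D : ℤ} (hD : -2 ≤ D) (s : List ℕ) {t : ℕ}
    {g : ℕ → ℚ} (hs : IsAdmissible L t s) (hg : g ∈ ratFun t D) :
    (fun k => ∑ m ∈ Finset.range k, g m * harmonicSum s m) ∈ harmonicSpan L (D + 1) ⊔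
      Submodule.span ℚ (harmonicSum '' {s | IsAdmissible L 0 s ∧
        (D = -2 → s ≠ [] → 2 ≤ s.headI)}) := by
  set M := harmonicSpan L (D + 1) ⊔ Submodule.span ℚ (harmonicSum '' {s | IsAdmissible L 0 s ∧
        (D = -2 → s ≠ [] → 2 ≤ s.headI)}) with hM
  have hspan : ∀ s, IsAdmissible L 0 s → (D = -2 → s ≠ [] → 2 ≤ s.headI) → harmonicSum s ∈ M :=
    fun s h1 h2 => Submodule.mem_sup_right (Submodule.subset_span ⟨s, ⟨h1, h2⟩, rfl⟩)
  induction s generalizing t g with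
  | nil =>
    obtain ⟨c, G, hG, hc, h⟩ := ratFun.exists_decomposition hD hg
    have h1 : ∑ u ∈ Finset.Icc 1 t, c u • harmonicSum [u] ∈ M := sum_mem fun u hu => by
      rw [Finset.mem_Icc] at hu
      by_cases hu1 : D = -2 ∧ u = 1
      · rw [hu1.2, hc hu1.1, zero_smul]
        exact zero_mem _
      · refine Submodule.smul_mem _ _ (hspan _ ((hs.mono hu.2).close hu.1) fun hD _ => ?_)
        rw [List.headI_cons]
        omega
    have h2 : G * harmonicSum [] ∈ M :=
      Submodule.mem_sup_left (mul_mem_of_isAdmissible hs hG)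
    have h3 : G 0 • harmonicSum [] ∈ M :=
      Submodule.smul_mem _ _ (hspan [] (.nil_right L) (by simp))
    convert sub_mem (add_mem h1 h2) h3 using 1
    ext k
    rw [sum_mul_harmonicSum_eq c _ g G [] h]
    simp [harmonicSum]
  | cons a s ih =>
    obtain ⟨c, G, hG, hc, h⟩ := ratFun.exists_decomposition hD hg
    have ha : 1 ≤ a := hs.one_le_of_mem a (by simp)
    have h1 : ∑ u ∈ Finset.Icc 1 t, c u • harmonicSum (u :: a :: s) ∈ M := sum_mem fun u hu => by
      rw [Finset.mem_Icc] at hu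
      by_cases hu1 : D = -2 ∧ u = 1
      · rw [hu1.2, hc hu1.1, zero_smul]
        exact zero_mem _
      · refine Submodule.smul_mem _ _ (hspan _ ((hs.mono hu.2).close hu.1) fun hD _ => ?_)
        rw [List.headI_cons]
        omega
    have h2 : G * harmonicSum (a :: s) ∈ M :=
      Submodule.mem_sup_left (mul_mem_of_isAdmissible hs hG)
    have h3 := ih hs.merge (ratFun.mono le_rfl (by omega : D + 1 + -(a : ℤ) ≤ D)
      (ratFun.mul_mem (ratFun.shift_mem hG) (ratFun.inv_pow_mem a)))
    convert sub_mem (add_mem h1 h2) h3 using 1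
    ext k
    rw [sum_mul_harmonicSum_eq c _ g G (a :: s) h]
    simp only [harmonicSum_cons_succ, Pi.sub_apply, Pi.add_apply, Pi.mul_apply, Finset.sum_apply,
      Pi.smul_apply, smul_eq_mul, add_sub_cancel_left, mul_assoc]
    simp [harmonicSum]

lemma sum_mem_sup {L : List ℕ} {D : ℤ} (hD : -2 ≤ D) {f : ℕ → ℚ} (hf : f ∈ harmonicSpan L D) :
    (fun k => ∑ m ∈ Finset.range k, f m) ∈ harmonicSpan L (D + 1) ⊔
      Submodule.span ℚ (harmonicSum '' {s | IsAdmissible L 0 s ∧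
        (D = -2 → s ≠ [] → 2 ≤ s.headI)}) := by
  induction hf using Submodule.span_induction with
  | zero =>
    simp only [Pi.zero_apply, Finset.sum_const_zero]
    exact zero_mem _
  | add x y _ _ hx hy =>
    simp only [Pi.add_apply, Finset.sum_add_distrib]
    exact add_mem hx hy
  | smul c x _ hx =>
    simp only [Pi.smul_apply, ← Finset.smul_sum]
    exact Submodule.smul_mem _ c hx
  | mem f hf =>
    obtain ⟨t, s, g, hs, hg, rfl⟩ := hf
    exact sum_mul_harmonicSum_mem hD s hs hg

lemma sum_mem_of_neg_one_le {L : List ℕ} {D : ℤ} (hD : -1 ≤ D) {f : ℕ → ℚ}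
    (hf : f ∈ harmonicSpan L D) :
    (fun k => ∑ m ∈ Finset.range k, f m) ∈ harmonicSpan L (D + 1) := by
  refine sup_le (c := harmonicSpan L (D + 1)) le_rfl (Submodule.span_le.2 ?_)
    (sum_mem_sup (by omega) hf)
  rintro _ ⟨s, ⟨hs, -⟩, rfl⟩
  exact harmonicSum_mem (by omega) hs

lemma sum_mem_of_neg_two {L : List ℕ} {f : ℕ → ℚ} (hf : f ∈ harmonicSpan L (-2)) :
    (fun k => ∑ m ∈ Finset.range k, f m) ∈ harmonicSpan L (-1) ⊔
      Submodule.span ℚ (harmonicSum '' convergentExponents L) := by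
  simpa [convergentExponents] using sum_mem_sup le_rfl hf

end harmonicSpan

/-- The sum of `∏ i, f i (k i - 1)` over the tuples of positive integers `k 0, …, k (n - 1) ≤ N`
such that `k j + c ≤ k i` for `i < j`. -/
def nestedSum (c : ℕ) : ℕ → (ℕ → ℕ → ℚ) → ℕ → ℚ
  | 0, _, _ => 1
  | n + 1, f, N => ∑ m ∈ Finset.range N, f 0 m * nestedSum c n (fun i => f (i + 1)) (m + 1 - c)

lemma nestedSum_mem_harmonicSpan (n : ℕ) (f : ℕ → ℕ → ℚ) (A : ℕ → ℕ) (E : ℕ → ℤ) {D : ℤ}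
    (hD : 0 ≤ D) (hf : ∀ i < n, f i ∈ ratFun (A i) (E i))
    (hE : ∀ j < n, ∑ i ∈ Finset.range (j + 1), (E i + 1) ≤ D) :
    nestedSum 0 n f ∈ harmonicSpan (List.ofFn fun i : Fin n => A i) D := by
  induction n generalizing f A E D with
  | zero => exact harmonicSpan.harmonicSum_mem hD (.nil_right _)
  | succ n ih =>
    have h0 : E 0 + 1 ≤ D := by simpa using hE 0 n.succ_pos
    have h1 := ih (fun i => f (i + 1)) (fun i => A (i + 1)) (fun i => E (i + 1))
      (D := D - 1 - E 0) (by omega) (fun i hi => hf _ (by omega)) fun j hj => by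
        have := hE (j + 1) (by omega)
        rw [Finset.sum_range_succ'] at this
        omega
    have h2 := harmonicSpan.mul_mem (hf 0 n.succ_pos) (harmonicSpan.shift_mem h1)
    rw [show E 0 + (D - 1 - E 0) = D - 1 by ring] at h2
    have h3 := harmonicSpan.sum_mem_of_neg_one_le (by omega) h2
    rw [sub_add_cancel] at h3
    rw [List.ofFn_succ]
    exact h3

lemma nestedSum_mem_sup (n : ℕ) (hn : 0 < n) (f : ℕ → ℕ → ℚ) (A : ℕ → ℕ) (E : ℕ → ℤ)
    (hf : ∀ i < n, f i ∈ ratFun (A i) (E i))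
    (hE : ∀ j < n, ∑ i ∈ Finset.range (j + 1), (E i + 1) ≤ -1) :
    nestedSum 0 n f ∈ harmonicSpan (List.ofFn fun i : Fin n => A i) (-1) ⊔
      Submodule.span ℚ (harmonicSum '' convergentExponents (List.ofFn fun i : Fin n => A i)) := by
  obtain ⟨n, rfl⟩ : ∃ m, n = m + 1 := ⟨n - 1, by omega⟩
  have h0 : E 0 + 1 ≤ -1 := by simpa using hE 0 n.succ_pos
  have h1 := nestedSum_mem_harmonicSpan n (fun i => f (i + 1)) (fun i => A (i + 1))
    (fun i => E (i + 1)) (D := -2 - E 0) (by omega) (fun i hi => hf _ (by omega)) fun j hj => by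
      have := hE (j + 1) (by omega)
      rw [Finset.sum_range_succ'] at this
      omega
  have h2 := harmonicSpan.mul_mem (hf 0 n.succ_pos) (harmonicSpan.shift_mem h1)
  rw [show E 0 + (-2 - E 0) = -2 by ring] at h2
  rw [List.ofFn_succ]
  exact harmonicSpan.sum_mem_of_neg_two h2

/-- The tuples of integers in `[1, N]` with `k j + c ≤ k i` for `i < j`. -/
def boundedTuples (c n N : ℕ) : Finset (Fin n → ℕ) :=
  (Fintype.piFinset fun _ => Finset.Icc 1 N).filter fun k => ∀ i j, i < j → k j + c ≤ k i

lemma mem_boundedTuples {c n N : ℕ} {k : Fin n → ℕ} :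
    k ∈ boundedTuples c n N ↔ (∀ i, 1 ≤ k i ∧ k i ≤ N) ∧ ∀ i j, i < j → k j + c ≤ k i := by
  simp [boundedTuples]

lemma sum_boundedTuples {c : ℕ} (hc : c ≤ 1) (n N : ℕ) (f : ℕ → ℕ → ℚ) :
    ∑ k ∈ boundedTuples c n N, ∏ i : Fin n, f i (k i - 1) = nestedSum c n f N := by
  induction n generalizing N f with
  | zero =>
    rw [Finset.sum_eq_card_nsmul (b := 1) (fun k _ => by simp)]
    have : boundedTuples c 0 N = {default} := by
      ext k
      simp [mem_boundedTuples, Subsingleton.elim k default]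
    simp [this, nestedSum]
  | succ n ih =>
    rw [nestedSum]
    simp only [← ih, Finset.mul_sum]
    rw [Finset.sum_sigma']
    refine Finset.sum_nbij' (fun k => ⟨k 0 - 1, Fin.tail k⟩)
      (fun x => Fin.cons (x.1 + 1) x.2) ?_ ?_ ?_ ?_ ?_
    · intro k hk
      rw [mem_boundedTuples] at hk
      rw [Finset.mem_sigma, Finset.mem_range, mem_boundedTuples]
      have h0 := hk.1 0
      refine ⟨by dsimp only; omega, fun i => ⟨(hk.1 i.succ).1, ?_⟩,
        fun i j hij => hk.2 _ _ (Fin.succ_lt_succ_iff.2 hij)⟩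
      have := hk.2 0 i.succ (Fin.succ_pos i)
      simp only [Fin.tail]
      omega
    · rintro ⟨m, k⟩ hk
      rw [Finset.mem_sigma, Finset.mem_range, mem_boundedTuples] at hk
      obtain ⟨hm, h1, h2⟩ := hk
      dsimp only at hm h1 h2 ⊢
      rw [mem_boundedTuples]
      refine ⟨fun i => ?_, fun i j hij => ?_⟩
      · refine Fin.cases ?_ (fun i => ?_) i
        · simp only [Fin.cons_zero]
          omega
        · have := h1 i
          simp only [Fin.cons_succ]
          omega
      · obtain ⟨j, rfl⟩ := Fin.exists_succ_eq.2 (Fin.ne_zero_of_lt hij)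
        revert hij
        refine Fin.cases (fun _ => ?_) (fun i hij => ?_) i
        · have := h1 j
          simp only [Fin.cons_zero, Fin.cons_succ]
          omega
        · simpa only [Fin.cons_succ] using h2 i j (Fin.succ_lt_succ_iff.1 hij)
    · intro k hk
      rw [mem_boundedTuples] at hk
      have h0 := (hk.1 0).1
      dsimp only
      rw [Nat.sub_add_cancel h0, Fin.cons_self_tail]
    · rintro ⟨m, k⟩ hk
      simp
    · intro k hk
      rw [Fin.prod_univ_succ]
      rfl

open Filter Topology in
lemma hasSum_of_tendsto_nestedSum {c : ℕ} (hc : c ≤ 1) {n : ℕ} {f : ℕ → ℕ → ℚ}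
    (hf : ∀ i m, 0 ≤ f i m) {v : ℝ}
    (h : Tendsto (fun N => (nestedSum c n f N : ℝ)) atTop (𝓝 v)) {S : (Fin n → ℕ) → Prop}
    (hS : ∀ k, S k ↔ ∀ i j, i < j → k j + c ≤ k i) :
    HasSum (fun k : {k : Fin n → ℕ // S k ∧ ∀ i, 1 ≤ k i} =>
      ∏ i : Fin n, (f i (k.1 i - 1) : ℝ)) v := by
  classical
  set F : {k : Fin n → ℕ // S k ∧ ∀ i, 1 ≤ k i} → ℝ :=
    fun k => ∏ i : Fin n, (f i (k.1 i - 1) : ℝ) with hF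
  have hF0 : ∀ k, 0 ≤ F k := fun k => Finset.prod_nonneg fun i _ => by exact_mod_cast hf _ _
  set T : ℕ → Finset {k : Fin n → ℕ // S k ∧ ∀ i, 1 ≤ k i} :=
    fun N => (boundedTuples c n N).subtype _ with hT
  have hTsum : ∀ N, ∑ k ∈ T N, F k = (nestedSum c n f N : ℝ) := fun N => by
    rw [← sum_boundedTuples hc, hT]
    push_cast
    have := Finset.sum_subtype_of_mem (p := fun k => S k ∧ ∀ i, 1 ≤ k i) (s := boundedTuples c n N)
      (fun k : Fin n → ℕ => ∏ i : Fin n, (f i (k i - 1) : ℝ)) fun k hk => ?_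
    · exact this
    rw [mem_boundedTuples] at hk
    exact ⟨(hS k).2 hk.2, fun i => (hk.1 i).1⟩
  have hTtop : Tendsto T atTop atTop := by
    refine tendsto_atTop_finset_of_monotone (fun M N hMN k hk => ?_) fun k =>
      ⟨∑ i, k.1 i, ?_⟩
    · rw [hT, Finset.mem_subtype, mem_boundedTuples] at hk ⊢
      exact ⟨fun i => ⟨(hk.1 i).1, (hk.1 i).2.trans hMN⟩, hk.2⟩
    · rw [hT, Finset.mem_subtype, mem_boundedTuples]
      exact ⟨fun i => ⟨k.2.2 i, Finset.single_le_sum (fun _ _ => Nat.zero_le _)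
        (Finset.mem_univ i)⟩, (hS _).1 k.2.1⟩
  have hmono : Monotone fun s : Finset {k : Fin n → ℕ // S k ∧ ∀ i, 1 ≤ k i} => ∑ k ∈ s, F k :=
    fun s t hst => Finset.sum_le_sum_of_subset_of_nonneg hst fun k _ _ => hF0 k
  simp_rw [← hTsum] at h
  exact (tendsto_iff_tendsto_subseq_of_monotone hmono hTtop).2 h

lemma harmonicSum_eq_nestedSum (s : List ℕ) :
    harmonicSum s = nestedSum 1 s.length fun i m => (((m : ℚ) + 1) ^ s.getD i 0)⁻¹ := by
  induction s with
  | nil => rfl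
  | cons a s ih =>
    ext k
    simp only [harmonicSum, ih, List.length_cons, nestedSum, List.getD_cons_zero,
      List.getD_cons_succ, Nat.add_sub_cancel]

open Filter Topology in
lemma mzv_eq_of_tendsto {s : List ℕ} {v : ℝ}
    (h : Tendsto (fun k => (harmonicSum s k : ℝ)) atTop (𝓝 v)) : mzv s = v := by
  rw [harmonicSum_eq_nestedSum] at h
  refine ((hasSum_of_tendsto_nestedSum le_rfl (fun i m => by positivity) h
    (S := StrictAnti) fun k => ?_).congr_fun ?_).tsum_eq
  · exact forall₃_congr fun i j _ => Iff.rfl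
  · rintro ⟨k, -, hk⟩
    refine Finset.prod_congr rfl fun i _ => ?_
    simp [Nat.cast_sub (hk i)]

lemma harmonicSum_nonneg (s : List ℕ) (k : ℕ) : 0 ≤ harmonicSum s k := by
  induction s generalizing k with
  | nil => exact zero_le_one
  | cons a s ih => exact Finset.sum_nonneg fun m _ => mul_nonneg (by positivity) (ih m)

lemma harmonicSum_le_harmonic_pow {s : List ℕ} (hs : ∀ a ∈ s, 1 ≤ a) (k : ℕ) :
    harmonicSum s k ≤ harmonic k ^ s.length := by
  induction s generalizing k with
  | nil => simp [harmonicSum]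
  | cons a s ih =>
    have hs' : ∀ a ∈ s, 1 ≤ a := fun b hb => hs b (by simp [hb])
    have ha : a ≠ 0 := by have := hs a (by simp); omega
    have hmono : Monotone harmonic := monotone_nat_of_le_succ fun m => by
      rw [harmonic_succ]
      linarith [show (0 : ℚ) ≤ (↑(m + 1))⁻¹ by positivity]
    rw [harmonicSum, List.length_cons, pow_succ', harmonic, Finset.sum_mul]
    refine Finset.sum_le_sum fun m hm => ?_
    have hx : (1 : ℚ) ≤ (m : ℚ) + 1 := by linarith [(Nat.cast_nonneg m : (0 : ℚ) ≤ m)]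
    have h0 : 0 ≤ harmonic m := by
      rw [harmonic]
      exact Finset.sum_nonneg fun i _ => by positivity
    have h1 : harmonic m ^ s.length ≤ harmonic k ^ s.length :=
      pow_le_pow_left₀ h0 (hmono (Finset.mem_range.1 hm).le) _
    have h2 : (((m : ℚ) + 1) ^ a)⁻¹ ≤ ((m + 1 : ℕ) : ℚ)⁻¹ := by
      push_cast
      exact inv_anti₀ (by positivity) (le_self_pow₀ hx ha)
    exact mul_le_mul h2 ((ih hs' m).trans h1) (harmonicSum_nonneg _ _) (by positivity)

open Filter Topology Asymptotics in
lemma harmonicSum_isBigO_rpow {s : List ℕ} (hs : ∀ a ∈ s, 1 ≤ a) :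
    (fun k => (harmonicSum s k : ℝ)) =O[atTop] fun k : ℕ => (k : ℝ) ^ (1 / 2 : ℝ) := by
  have h1 : (fun k => (harmonicSum s k : ℝ)) =O[atTop]
      fun k : ℕ => (1 + Real.log k) ^ s.length := by
    refine IsBigO.of_bound 1 (Eventually.of_forall fun k => ?_)
    rw [one_mul, Real.norm_of_nonneg (by exact_mod_cast harmonicSum_nonneg s k)]
    refine le_trans ?_ (le_abs_self _)
    calc (harmonicSum s k : ℝ) ≤ (harmonic k : ℝ) ^ s.length := by
          exact_mod_cast harmonicSum_le_harmonic_pow hs k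
      _ ≤ _ := pow_le_pow_left₀ (by
          rw [harmonic]; exact_mod_cast Finset.sum_nonneg fun i _ => by positivity)
          (harmonic_le_one_add_log k) _
  refine h1.trans ?_
  have h2 : (fun x : ℝ => 1 + Real.log x) =O[atTop] Real.log :=
    (Real.isLittleO_const_log_atTop.isBigO).add (isBigO_refl _ _)
  have h3 := (isLittleO_log_rpow_rpow_atTop (s.length : ℝ) (one_half_pos (α := ℝ))).isBigO
  simp only [Real.rpow_natCast] at h3
  exact ((h2.pow s.length).trans h3).comp_tendsto tendsto_natCast_atTop_atTop

open Filter Topology Asymptotics in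
lemma tendsto_harmonicSum {s : List ℕ} (hs : ∀ a ∈ s, 1 ≤ a) (h2 : s ≠ [] → 2 ≤ s.headI) :
    Tendsto (fun k => (harmonicSum s k : ℝ)) atTop (𝓝 (mzv s)) := by
  suffices h : ∃ v, Tendsto (fun k => (harmonicSum s k : ℝ)) atTop (𝓝 v) by
    obtain ⟨v, hv⟩ := h
    rwa [mzv_eq_of_tendsto hv]
  cases s with
  | nil => exact ⟨1, by simp [harmonicSum]⟩
  | cons a s =>
    have ha : 2 ≤ a := h2 (by simp)
    have hS : Summable fun m : ℕ => ((((m : ℝ) + 1) ^ a)⁻¹ * (harmonicSum s m : ℝ)) := by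
      refine summable_of_isBigO_nat (Real.summable_nat_rpow.2
        (show (-2 + 1 / 2 : ℝ) < -1 by norm_num)) ?_
      have h1 : (fun m : ℕ => (((m : ℝ) + 1) ^ a)⁻¹) =O[atTop] fun m : ℕ => (m : ℝ) ^ (-2 : ℝ) := by
        refine IsBigO.of_bound 1 ((eventually_ge_atTop 1).mono fun m hm => ?_)
        have hm' : (1 : ℝ) ≤ m := by exact_mod_cast hm
        rw [one_mul, Real.norm_of_nonneg (by positivity), Real.norm_of_nonneg (by positivity),
          Real.rpow_neg (by positivity), Real.rpow_two]
        refine inv_anti₀ (by positivity) ?_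
        exact (pow_le_pow_left₀ (by positivity) (by linarith) 2).trans
          (pow_le_pow_right₀ (by linarith) ha)
      refine (h1.mul (harmonicSum_isBigO_rpow fun b hb => hs b (by simp [hb]))).congr'
        EventuallyEq.rfl ((eventually_ge_atTop 1).mono fun m hm => ?_)
      exact (Real.rpow_add (by exact_mod_cast hm) _ _).symm
    refine ⟨_, hS.hasSum.tendsto_sum_nat.congr fun k => ?_⟩
    rw [harmonicSum]
    push_cast
    rfl

open Filter Topology Asymptotics in
lemma tendsto_zero_of_mem_harmonicSpan {L : List ℕ} {f : ℕ → ℚ} (hf : f ∈ harmonicSpan L (-1)) :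
    Tendsto (fun k => (f k : ℝ)) atTop (𝓝 0) := by
  induction hf using Submodule.span_induction with
  | zero => simp
  | add x y _ _ hx hy => simpa using hx.add hy
  | smul a x _ hx => simpa using hx.const_mul (a : ℝ)
  | mem f hf =>
    obtain ⟨t, s, g, hs, hg, rfl⟩ := hf
    obtain ⟨C, hC, hC'⟩ := ratFun.exists_bound hg
    have h1 : (fun k => (g k : ℝ)) =O[atTop] fun k : ℕ => (k : ℝ) ^ (-1 : ℝ) := by
      refine IsBigO.of_bound C ((eventually_ge_atTop 1).mono fun k hk => ?_)
      have hk' : (0 : ℝ) < k := by exact_mod_cast hk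
      rw [Real.rpow_neg_one, norm_inv, Real.norm_of_nonneg hk'.le, ← div_eq_mul_inv]
      calc |(g k : ℝ)| ≤ C / ((k : ℝ) + 1) := by exact_mod_cast hC' k
        _ ≤ C / k := div_le_div_of_nonneg_left (by exact_mod_cast hC) hk' (by linarith)
    have h2 : (fun k => ((g * harmonicSum s) k : ℝ)) =O[atTop]
        fun k : ℕ => (k : ℝ) ^ (-(1 / 2) : ℝ) := by
      refine (h1.mul (harmonicSum_isBigO_rpow hs.one_le_of_mem)).congr'
        (Eventually.of_forall fun k => by simp)
        ((eventually_ge_atTop 1).mono fun k hk => ?_)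
      simp only
      rw [← Real.rpow_add (by exact_mod_cast hk)]
      norm_num
    exact h2.trans_tendsto
      ((tendsto_rpow_neg_atTop (by norm_num)).comp tendsto_natCast_atTop_atTop)

open Filter Topology in
lemma exists_tendsto_of_mem_span {S : Set (List ℕ)} {f : ℕ → ℚ}
    (hS : ∀ s ∈ S, (∀ a ∈ s, 1 ≤ a) ∧ (s ≠ [] → 2 ≤ s.headI))
    (hf : f ∈ Submodule.span ℚ (harmonicSum '' S)) :
    ∃ v ∈ Submodule.span ℚ (mzv '' S), Tendsto (fun k => (f k : ℝ)) atTop (𝓝 v) := by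
  induction hf using Submodule.span_induction with
  | zero => exact ⟨0, zero_mem _, by simp⟩
  | add x y _ _ hx hy =>
    obtain ⟨v, hv, hx⟩ := hx
    obtain ⟨w, hw, hy⟩ := hy
    exact ⟨v + w, add_mem hv hw, by simpa using hx.add hy⟩
  | smul a x _ hx =>
    obtain ⟨v, hv, hx⟩ := hx
    refine ⟨a • v, Submodule.smul_mem _ a hv, ?_⟩
    rw [Rat.smul_def]
    simpa using hx.const_mul (a : ℝ)
  | mem f hf =>
    obtain ⟨s, hs, rfl⟩ := hf
    exact ⟨_, Submodule.subset_span ⟨s, hs, rfl⟩, tendsto_harmonicSum (hS s hs).1 (hS s hs).2⟩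

open Polynomial in
lemma ratFun.pow_div_ascPochhammer_pow_mem (d r n a : ℕ) :
    (fun m : ℕ => ((m : ℚ) + 1) ^ d / ((ascPochhammer ℚ n).eval ((m : ℚ) + 1 + r)) ^ a) ∈
      ratFun a (d - a * n) := by
  refine mem_of_natDegree_le (N := r + n) (p := X ^ d * ascPochhammer ℚ r ^ a) ?_ fun k => ?_
  · rw [((monic_X_pow d).natDegree_mul ((monic_ascPochhammer ℚ r).pow a)), natDegree_X_pow,
      (monic_ascPochhammer ℚ r).natDegree_pow, ascPochhammer_natDegree]
    push_cast
    linarith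
  · rw [eval_ascPochhammer_mul, mul_pow, eval_mul, eval_pow, eval_pow, eval_X, mul_comm,
      mul_div_mul_left _ _ (pow_ne_zero _ (ascPochhammer_eval_ne_zero r k))]
    simp [eval_comp]

lemma eval_ascPochhammer_map {R S : Type*} [Semiring R] [Semiring S] (f : R →+* S) (n : ℕ)
    (x : R) : (ascPochhammer S n).eval (f x) = f ((ascPochhammer R n).eval x) := by
  rw [← ascPochhammer_map f, Polynomial.eval_map_apply]

/-- The sum of a monomial divided by powers of Pochhammer symbols. -/
lemma exists_hasSum_monomial {p : ℕ} (hp : 0 < p) (A n r d : ℕ → ℕ)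
    (h : ∀ j < p, ∑ i ∈ Finset.range (j + 1), d i + j + 2 ≤
      ∑ i ∈ Finset.range (j + 1), A i * (n i + 1)) :
    ∃ v ∈ Submodule.span ℚ (mzv '' convergentExponents (List.ofFn fun i : Fin p => A i)),
      HasSum (fun k : {k : Fin p → ℕ // Antitone k ∧ ∀ i, 1 ≤ k i} =>
        (∏ i : Fin p, (k.1 i : ℝ) ^ d i) / ∏ i : Fin p,
          ((ascPochhammer ℝ (n i + 1)).eval ((k.1 i : ℝ) + r i)) ^ A i) v := by
  set f : ℕ → ℕ → ℚ := fun i m =>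
    ((m : ℚ) + 1) ^ d i / ((ascPochhammer ℚ (n i + 1)).eval ((m : ℚ) + 1 + r i)) ^ A i with hf
  obtain ⟨g, hg, w, hw, hgw⟩ := Submodule.mem_sup.1 <| nestedSum_mem_sup p hp f A
    (fun i => d i - A i * (n i + 1 : ℕ)) (fun i _ => ratFun.pow_div_ascPochhammer_pow_mem _ _ _ _)
    fun j hj => by
      rw [Finset.sum_add_distrib, Finset.sum_sub_distrib]
      simp only [Finset.sum_const, Finset.card_range, nsmul_eq_mul, mul_one]
      have := h j hj
      zify at this
      push_cast
      linarith
  obtain ⟨v, hv, hwv⟩ := exists_tendsto_of_mem_span (fun s hs => ⟨hs.1.one_le_of_mem, hs.2⟩) hw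
  have hlim := (tendsto_zero_of_mem_harmonicSpan hg).add hwv
  rw [zero_add] at hlim
  refine ⟨v, hv, (hasSum_of_tendsto_nestedSum (f := f) zero_le_one (fun i m => ?_)
    (hlim.congr fun k => ?_) (S := Antitone) fun k => ?_).congr_fun ?_⟩
  · exact div_nonneg (by positivity) (pow_nonneg (ascPochhammer_pos _ _ (by positivity)).le _)
  · rw [← hgw]
    simp
  · simp only [add_zero]
    exact ⟨fun hk i j hij => hk hij.le, fun hk i j hij => hij.eq_or_lt.elim
      (fun h => h ▸ le_rfl) (hk i j)⟩
  · rintro ⟨k, -, hk⟩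
    rw [← Finset.prod_div_distrib]
    refine Finset.prod_congr rfl fun i _ => ?_
    have hk' : ((k i - 1 : ℕ) : ℚ) + 1 = k i := by
      rw [Nat.cast_sub (hk i)]
      simp
    have h3 : (ascPochhammer ℝ (n i + 1)).eval ((k i : ℝ) + r i) =
        ((ascPochhammer ℚ (n i + 1)).eval ((k i : ℚ) + r i) : ℚ) := by
      simpa using eval_ascPochhammer_map (Rat.castHom ℝ) (n i + 1) ((k i : ℚ) + r i)
    simp only [hf, hk', h3]
    push_cast
    rfl

lemma ofReal_mem_span {K : Subfield ℂ} {S : Set (List ℕ)} {v : ℝ}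
    (hv : v ∈ Submodule.span ℚ (mzv '' S)) :
    (v : ℂ) ∈ Submodule.span K ((fun s => (mzv s : ℂ)) '' S) := by
  induction hv using Submodule.span_induction with
  | zero => simp
  | add x y _ _ hx hy => simpa using add_mem hx hy
  | smul a x _ hx =>
    have := Submodule.smul_mem _ (a : K) hx
    rw [Rat.smul_def]
    push_cast
    convert this using 1
    rw [Subfield.smul_def]
    simp
  | mem x hx =>
    obtain ⟨s, hs, rfl⟩ := hx
    exact Submodule.subset_span ⟨s, hs, rfl⟩

lemma convergentExponents_spec {p : ℕ} {A : ℕ → ℕ} {s : List ℕ}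
    (hs : s ∈ convergentExponents (List.ofFn fun i : Fin p => A i)) :
    s.length ≤ p ∧ (∀ a ∈ s, 1 ≤ a) ∧ (s ≠ [] → 2 ≤ s.headI) ∧
      s.sum ≤ ∑ i ∈ Finset.range p, A i ∧
      (s ≠ [] →
        ∃ ℓ : ℕ → ℕ, ℓ 0 = 0 ∧ ℓ s.length = p ∧ StrictMonoOn ℓ (Set.Iic s.length) ∧
          ∀ j : Fin s.length, s.get j ≤ ∑ i ∈ Finset.Ico (ℓ j.1) (ℓ (j.1 + 1)), A i) := by
  obtain ⟨hs, h2⟩ := hs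
  refine ⟨by simpa using hs.length_le, hs.one_le_of_mem, h2, ?_, fun hne => ?_⟩
  · have := hs.add_sum_le
    rwa [zero_add, List.sum_ofFn, Fin.sum_univ_eq_sum_range] at this
  · obtain ⟨ℓ, h3, h4, -, h5⟩ := hs.exists_blocks
    have hpos : 0 < s.length := List.length_pos_iff.2 hne
    have hA : ∀ i, (List.ofFn fun i : Fin p => A i).getD i 0 ≤ A i := fun i => by
      by_cases hi : i < p <;> simp [List.getD_eq_getElem?_getD, hi]
    have hle : ∀ j, Function.update ℓ 0 0 j ≤ ℓ j := fun j => by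
      by_cases hj : j = 0 <;> simp [hj]
    refine ⟨Function.update ℓ 0 0, by simp, ?_, fun i hi j hj hij => ?_, fun j => ?_⟩
    · rw [Function.update_of_ne hpos.ne', h3, List.length_ofFn]
    · rw [Function.update_of_ne (f := ℓ) (Nat.ne_zero_of_lt hij)]
      exact (hle i).trans_lt (h4 hi hj hij)
    · rw [Function.update_of_ne (f := ℓ) (Nat.succ_ne_zero _)]
      exact (h5 j).trans <| (Finset.sum_le_sum fun i _ => hA i).trans <|
        Finset.sum_le_sum_of_subset (Finset.Ico_subset_Ico_left (hle _))

lemma sum_Iic_fin {p j : ℕ} (hj : j < p) (g : ℕ → ℕ) :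
    ∑ i ∈ Finset.Iic (⟨j, hj⟩ : Fin p), g i = ∑ i ∈ Finset.range (j + 1), g i := by
  rw [Nat.range_succ_eq_Iic, ← Fin.map_valEmbedding_Iic ⟨j, hj⟩, Finset.sum_map]
  rfl

theorem statement0 (p : ℕ) (hp : 0 < p) (A n r : ℕ → ℕ) (K : Subfield ℂ)
    (P : MvPolynomial (Fin p) K)
    (h9 : ∀ j : Fin p, (∑ i ∈ Finset.Iic j, P.degreeOf i) + j.1 + 2 ≤
      ∑ i ∈ Finset.Iic j, A i.1 * (n i.1 + 1)) :
    Summable (fun k : {k : Fin p → ℕ // Antitone k ∧ ∀ i, 1 ≤ k i} =>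
        Rfun p K A n r P (fun i => (k.1 i : ℂ))) ∧
    ∃ (T : Finset (List ℕ)) (c : List ℕ → K),
      (∀ s ∈ T, s.length ≤ p ∧ (∀ a ∈ s, 1 ≤ a) ∧ (s ≠ [] → 2 ≤ s.headI) ∧
        s.sum ≤ ∑ i ∈ Finset.range p, A i ∧
        (s ≠ [] →
        ∃ ℓ : ℕ → ℕ, ℓ 0 = 0 ∧ ℓ s.length = p ∧ StrictMonoOn ℓ (Set.Iic s.length) ∧
          ∀ j : Fin s.length, s.get j ≤ ∑ i ∈ Finset.Ico (ℓ j.1) (ℓ (j.1 + 1)), A i)) ∧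
      (∑' k : {k : Fin p → ℕ // Antitone k ∧ ∀ i, 1 ≤ k i},
          Rfun p K A n r P (fun i => (k.1 i : ℂ)))
        = ∑ s ∈ T, (c s : ℂ) * (mzv s : ℂ) := by
  have hmonomial : ∀ d ∈ P.support, ∃ v : ℝ,
      v ∈ Submodule.span ℚ (mzv '' convergentExponents (List.ofFn fun i : Fin p => A i)) ∧
      HasSum (fun k : {k : Fin p → ℕ // Antitone k ∧ ∀ i, 1 ≤ k i} =>
        (∏ i : Fin p, (k.1 i : ℝ) ^ d i) / ∏ i : Fin p,
          ((ascPochhammer ℝ (n i + 1)).eval ((k.1 i : ℝ) + r i)) ^ A i) v := by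
    intro d hd
    obtain ⟨v, hv, h⟩ := exists_hasSum_monomial hp A n r
      (fun i => if h : i < p then d ⟨i, h⟩ else 0) fun j hj => by
        rw [← sum_Iic_fin hj, ← sum_Iic_fin hj fun i => A i * (n i + 1)]
        refine le_trans ?_ (h9 ⟨j, hj⟩)
        gcongr with i
        simpa using MvPolynomial.monomial_le_degreeOf i hd
    exact ⟨v, hv, by simpa using h⟩
  choose! v hv hsum using hmonomial
  have htotal : HasSum (fun k : {k : Fin p → ℕ // Antitone k ∧ ∀ i, 1 ≤ k i} =>
      Rfun p K A n r P (fun i => (k.1 i : ℂ))) (∑ d ∈ P.support, ((P.coeff d : K) : ℂ) * v d) := by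
    refine (hasSum_sum fun d hd =>
      (Complex.hasSum_ofReal.2 (hsum d hd)).mul_left ((P.coeff d : K) : ℂ)).congr_fun fun k => ?_
    rw [Rfun, MvPolynomial.eval₂_eq', Finset.sum_div]
    refine Finset.sum_congr rfl fun d _ => ?_
    rw [mul_div_assoc]
    have h : ∀ i : Fin p, (ascPochhammer ℂ (n i + 1)).eval ((k.1 i : ℂ) + r i) =
        ((ascPochhammer ℝ (n i + 1)).eval ((k.1 i : ℝ) + r i) : ℝ) := fun i => by
      simpa using eval_ascPochhammer_map Complex.ofRealHom (n i + 1) ((k.1 i : ℝ) + r i)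
    simp [h]
  have hmem : ∑ d ∈ P.support, ((P.coeff d : K) : ℂ) * v d ∈
      Submodule.span K ((fun s => (mzv s : ℂ)) ''
        convergentExponents (List.ofFn fun i : Fin p => A i)) :=
    sum_mem fun d hd => Submodule.smul_mem _ (P.coeff d) (ofReal_mem_span (hv d hd))
  obtain ⟨l, hl, hl'⟩ := (Finsupp.mem_span_image_iff_linearCombination K).1 hmem
  refine ⟨htotal.summable, l.support, l, fun s hs => convergentExponents_spec (hl hs), ?_⟩
  rw [htotal.tsum_eq, ← hl', Finsupp.linearCombination_apply, Finsupp.sum]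
  rfl
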